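/- In the representation of the Boolean algebra of conditionals, for all events A, A' ⊆ Ω and all nonempty events B, B' ⊆ Ω: (i) (OR rule) ⟦A∣B⟧ ∩ ⟦A∣B'⟧ ⊆ ⟦A∣B∪B'⟧; (ii) if A ⊆ B∩B' then ⟦A∣B⟧ ∩ ⟦A∣B'⟧ = ⟦A∣B∪B'⟧; (iii) ⟦A∣B⟧ ⊆ ⟦(Ω∖B)∪A ∣ B∪B'⟧; (iv) (quasi-conjunction bound) ⟦A∣B⟧ ∩ ⟦A'∣B'⟧ ⊆ ⟦((Ω∖B)∪A) ∩ ((Ω∖B')∪A') ∣ B∪B'⟧. -/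

import Mathlib

open Finset

variable {Ω : Type*}

noncomputable def sigmaFirst [Fintype Ω] [DecidableEq Ω] [Nonempty Ω]
    (σ : Fin (Fintype.card Ω) ≃ Ω) (B : Finset Ω) : Ω :=
  if h : (Finset.univ.filter fun i => σ i ∈ B).Nonempty then
    σ ((Finset.univ.filter fun i => σ i ∈ B).min' h)
  else Classical.arbitrary Ω

def condEvent [Fintype Ω] [DecidableEq Ω] [Nonempty Ω]
    (A B : Finset Ω) : Set (Fin (Fintype.card Ω) ≃ Ω) :=
  {σ | sigmaFirst σ B ∈ A}

theorem sigmaFirst_eq_min' [Fintype Ω] [DecidableEq Ω] [Nonempty Ω]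
    (σ : Fin (Fintype.card Ω) ≃ Ω) {B : Finset Ω}
    (h : (Finset.univ.filter fun i => σ i ∈ B).Nonempty) :
    sigmaFirst σ B = σ ((Finset.univ.filter fun i => σ i ∈ B).min' h) :=
  dif_pos h

theorem filter_mem_nonempty [Fintype Ω] [DecidableEq Ω]
    (σ : Fin (Fintype.card Ω) ≃ Ω) {B : Finset Ω} (hB : B.Nonempty) :
    (Finset.univ.filter fun i => σ i ∈ B).Nonempty := by
  obtain ⟨b, hb⟩ := hB
  exact ⟨σ.symm b, by simpa using hb⟩

theorem sigmaFirst_mem [Fintype Ω] [DecidableEq Ω] [Nonempty Ω]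
    (σ : Fin (Fintype.card Ω) ≃ Ω) {B : Finset Ω} (hB : B.Nonempty) :
    sigmaFirst σ B ∈ B := by
  have h := filter_mem_nonempty σ hB
  rw [sigmaFirst_eq_min' σ h]
  exact (Finset.mem_filter.mp (Finset.min'_mem _ h)).2

theorem sigmaFirst_eq_of_subset_of_mem [Fintype Ω] [DecidableEq Ω] [Nonempty Ω]
    (σ : Fin (Fintype.card Ω) ≃ Ω) {B C : Finset Ω} (hBC : B ⊆ C)
    (h : sigmaFirst σ C ∈ B) : sigmaFirst σ B = sigmaFirst σ C := by
  have hB := filter_mem_nonempty σ ⟨_, h⟩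
  have hC := filter_mem_nonempty σ ⟨_, hBC h⟩
  rw [sigmaFirst_eq_min' σ hC] at h ⊢
  rw [sigmaFirst_eq_min' σ hB]
  congr 1
  refine le_antisymm (Finset.min'_le _ _ (by simpa using h)) (Finset.min'_subset _ ?_)
  exact Finset.monotone_filter_right _ fun i _ hi => hBC hi

theorem stmt4 [Fintype Ω] [DecidableEq Ω] [Nonempty Ω]
    (A A' B B' : Finset Ω) (hB : B.Nonempty) (hB' : B'.Nonempty) :
    condEvent A B ∩ condEvent A B' ⊆ condEvent A (B ∪ B') ∧
    (A ⊆ B ∩ B' → condEvent A B ∩ condEvent A B' = condEvent A (B ∪ B')) ∧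
    condEvent A B ⊆ condEvent ((Finset.univ \ B) ∪ A) (B ∪ B') ∧
    condEvent A B ∩ condEvent A' B' ⊆
      condEvent (((Finset.univ \ B) ∪ A) ∩ ((Finset.univ \ B') ∪ A')) (B ∪ B') := by
  have first_left (σ : Fin (Fintype.card Ω) ≃ Ω) (h : sigmaFirst σ (B ∪ B') ∈ B) :=
    sigmaFirst_eq_of_subset_of_mem σ Finset.subset_union_left h
  have first_right (σ : Fin (Fintype.card Ω) ≃ Ω) (h : sigmaFirst σ (B ∪ B') ∈ B') :=
    sigmaFirst_eq_of_subset_of_mem σ Finset.subset_union_right h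
  have or_rule : condEvent A B ∩ condEvent A B' ⊆ condEvent A (B ∪ B') := by
    rintro σ ⟨h, h'⟩
    simp only [condEvent, Set.mem_ofPred_eq] at h h' ⊢
    rcases Finset.mem_union.mp (sigmaFirst_mem σ (hB.mono Finset.subset_union_left)) with hm | hm
    · rwa [← first_left σ hm]
    · rwa [← first_right σ hm]
  refine ⟨or_rule, fun hA => or_rule.antisymm fun σ h => ?_, fun σ h => ?_, ?_⟩
  · simp only [condEvent, Set.mem_inter_iff, Set.mem_ofPred_eq] at h ⊢
    have hm := Finset.mem_inter.mp (hA h)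
    rw [first_left σ hm.1, first_right σ hm.2]
    exact ⟨h, h⟩
  · simp only [condEvent, Set.mem_ofPred_eq] at h ⊢
    have := first_left σ
    grind
  · rintro σ ⟨h, h'⟩
    simp only [condEvent, Set.mem_ofPred_eq] at h h' ⊢
    have := first_left σ
    have := first_right σ
    grind
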